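/- Let n be a positive integer and let α = (α_{ij})_{1≤i<j≤n} be a vector of real numbers. Then α is a reduced bounded ratio on positive Lorentzian matrices (i.e., there exists a constant c > 0 such that ∏_{1≤i<j≤n} p_{ij}^{α_{ij}} ≤ c for every normalized Lorentzian matrix (p_{ij}) with all entries positive) if and only if for every subset S ⊆ {1,…,n} one has ∑_{1≤i<j≤n} α_{ij}·δ(S)_{ij} ≤ 0, where δ(S) is the cut vector of S. In particular, the cone of reduced bounded ratios is the dual of the cut cone. -/

import Mathlib

/-- A Lorentzian matrix: real symmetric with nonnegative entries and at most one
positive eigenvalue (counted with multiplicity). -/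
def IsLorentzian {n : ℕ} (M : Matrix (Fin n) (Fin n) ℝ) : Prop :=
  M.IsSymm ∧ (∀ i j, 0 ≤ M i j) ∧
    ∀ (hM : M.IsHermitian),
      (Finset.univ.filter fun i => 0 < hM.eigenvalues i).card ≤ 1

/-- The finset of ordered pairs (i, j) with i < j, indexing the off-diagonal
entries of a symmetric matrix. -/
def offDiagPairs (n : ℕ) : Finset (Fin n × Fin n) :=
  Finset.univ.filter fun q => q.1 < q.2

/-- The cut vector of a subset S of {1, ..., n}. -/
def cutVec {n : ℕ} (S : Finset (Fin n)) : Fin n → Fin n → ℝ :=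
  fun i j => if (i ∈ S) ↔ (j ∈ S) then 0 else 1

open Matrix

theorem Matrix.IsHermitian.dotProduct_mulVec_eq_sum {n : ℕ} {M : Matrix (Fin n) (Fin n) ℝ}
    (hM : M.IsHermitian) (y : Fin n → ℝ) :
    y ⬝ᵥ M *ᵥ y = ∑ i, hM.eigenvalues i * (y ⬝ᵥ ⇑(hM.eigenvectorBasis i)) ^ 2 := by
  have hy : y = ∑ i, (y ⬝ᵥ ⇑(hM.eigenvectorBasis i)) • ⇑(hM.eigenvectorBasis i) := by
    have h := hM.eigenvectorBasis.sum_repr (WithLp.toLp 2 y)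
    have h' := congrArg (WithLp.ofLp) h
    simp only [WithLp.ofLp_sum, WithLp.ofLp_smul] at h'
    conv_lhs => rw [← h']
    refine Finset.sum_congr rfl fun i _ => ?_
    congr 1
    simp [OrthonormalBasis.repr_apply_apply, PiLp.inner_apply, dotProduct]
  have hMy : M *ᵥ y = ∑ i, (hM.eigenvalues i * (y ⬝ᵥ ⇑(hM.eigenvectorBasis i))) •
      ⇑(hM.eigenvectorBasis i) := by
    conv_lhs => rw [hy, Matrix.mulVec_sum]
    refine Finset.sum_congr rfl fun i _ => ?_
    rw [Matrix.mulVec_smul, hM.mulVec_eigenvectorBasis, smul_smul, mul_comm]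
  rw [hMy, dotProduct_sum]
  refine Finset.sum_congr rfl fun i _ => ?_
  rw [dotProduct_smul, smul_eq_mul]
  ring

theorem dotProduct_eigenvectorBasis {n : ℕ} {M : Matrix (Fin n) (Fin n) ℝ}
    (hM : M.IsHermitian) (i j : Fin n) :
    (⇑(hM.eigenvectorBasis i) : Fin n → ℝ) ⬝ᵥ ⇑(hM.eigenvectorBasis j) = if i = j then 1 else 0 := by
  have h := orthonormal_iff_ite.1 hM.eigenvectorBasis.orthonormal i j
  rw [← h]
  simp [PiLp.inner_apply, dotProduct, mul_comm]
theorem le_add_mul_length_of_walk {V : Type*} {ℓ : V → V → ℤ} {C t : ℤ} (hC : 0 ≤ C)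
    (hquasi : ∀ i j k, ℓ i k ≤ max (ℓ i j) (ℓ j k) + C) {G : SimpleGraph V}
    (hG : ∀ i j, G.Adj i j → ℓ i j ≤ t) {i j : V} (p : G.Walk i j) (hp : i ≠ j) :
    ℓ i j ≤ t + C * p.length := by
  induction p with
  | nil => exact absurd rfl hp
  | @cons u v w h p ih =>
    have h1 := hG _ _ h
    rcases eq_or_ne v w with rfl | hne
    · have : (0 : ℤ) ≤ C * ((SimpleGraph.Walk.cons h p).length : ℤ) := by positivity
      linarith
    · have h2 := ih hne
      have h3 := hquasi u v w
      have h4 : (0 : ℤ) ≤ C * (p.length : ℤ) := by positivity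
      have h5 : max (ℓ u v) (ℓ v w) ≤ t + C * p.length := max_le (by linarith) h2
      rw [SimpleGraph.Walk.length_cons]
      push_cast
      linarith

theorem le_of_transGen {n : ℕ} {ℓ : Fin n → Fin n → ℤ} {C t : ℤ} (hC : 0 ≤ C)
    (hsymm : ∀ i j, ℓ i j = ℓ j i)
    (hquasi : ∀ i j k, ℓ i k ≤ max (ℓ i j) (ℓ j k) + C) {i j : Fin n}
    (h : Relation.TransGen (fun a b => ℓ a b ≤ t) i j) :
    ℓ i j ≤ t + C * (n + 1) := by
  have h0 : (0 : ℤ) ≤ C * n := by positivity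
  rcases eq_or_ne i j with rfl | hne
  · obtain ⟨k, hk, -⟩ := Relation.TransGen.head'_iff.1 h
    have h1 := hquasi i k i
    rw [hsymm k i, max_self] at h1
    linarith
  · let G : SimpleGraph (Fin n) := SimpleGraph.fromRel fun a b => ℓ a b ≤ t
    have hG : ∀ a b, G.Adj a b → ℓ a b ≤ t := by
      rintro a b ⟨-, h | h⟩
      · exact h
      · rwa [hsymm]
    have hr : G.Reachable i j := by
      clear hne
      induction h with
      | @single b hb =>
        rcases eq_or_ne i b with rfl | hne
        · rfl
        · exact SimpleGraph.Adj.reachable ⟨hne, Or.inl hb⟩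
      | @tail b c _ hb ih =>
        rcases eq_or_ne b c with rfl | hne
        · exact ih
        · exact ih.trans (SimpleGraph.Adj.reachable ⟨hne, Or.inl hb⟩)
    obtain ⟨p, hp⟩ := hr.exists_isPath
    have h1 := le_add_mul_length_of_walk hC hquasi hG p hne
    have h2 : (p.length : ℤ) ≤ n := by
      have := hp.length_lt
      rw [Fintype.card_fin] at this
      exact_mod_cast this.le
    nlinarith

theorem IsLorentzian.dotProduct_mulVec_nonpos {n : ℕ} {M : Matrix (Fin n) (Fin n) ℝ}
    (hM : IsLorentzian M) {e x : Fin n → ℝ} (he : 0 < e ⬝ᵥ M *ᵥ e) (hx : x ⬝ᵥ M *ᵥ e = 0) :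
    x ⬝ᵥ M *ᵥ x ≤ 0 := by
  obtain ⟨hS, -, hev⟩ := hM
  have hH : M.IsHermitian := by
    rw [Matrix.IsHermitian, Matrix.conjTranspose_eq_transpose_of_trivial]; exact hS
  have hcard := Finset.card_le_one.1 (hev hH)
  have hx' : e ⬝ᵥ M *ᵥ x = 0 := by
    rw [dotProduct_mulVec, ← mulVec_transpose, hS.eq, dotProduct_comm, hx]
  by_contra! hpos
  obtain ⟨k, hk⟩ : ∃ k, 0 < hH.eigenvalues k := by
    by_contra! hall
    rw [hH.dotProduct_mulVec_eq_sum] at he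
    exact he.not_ge (Finset.sum_nonpos fun i _ =>
      mul_nonpos_of_nonpos_of_nonneg (hall i) (sq_nonneg _))
  have hneg : ∀ y : Fin n → ℝ, y ⬝ᵥ ⇑(hH.eigenvectorBasis k) = 0 → y ⬝ᵥ M *ᵥ y ≤ 0 := by
    intro y hy
    rw [hH.dotProduct_mulVec_eq_sum]
    refine Finset.sum_nonpos fun i _ => ?_
    rcases eq_or_ne i k with rfl | hik
    · simp [hy]
    · refine mul_nonpos_of_nonpos_of_nonneg (not_lt.1 fun hi => hik ?_) (sq_nonneg _)
      exact hcard i (by simpa using hi) k (by simpa using hk)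
  have hek : e ⬝ᵥ ⇑(hH.eigenvectorBasis k) ≠ 0 := fun h => he.not_ge (hneg e h)
  have h := hneg ((x ⬝ᵥ ⇑(hH.eigenvectorBasis k)) • e - (e ⬝ᵥ ⇑(hH.eigenvectorBasis k)) • x)
    (by simp only [sub_dotProduct, smul_dotProduct, smul_eq_mul]; ring)
  simp only [mulVec_sub, mulVec_smul, sub_dotProduct, smul_dotProduct, dotProduct_sub,
    dotProduct_smul, smul_eq_mul, hx, hx'] at h
  have h1 := mul_pos (sq_pos_of_ne_zero hek) hpos
  have h2 := mul_nonneg (sq_nonneg (x ⬝ᵥ ⇑(hH.eigenvectorBasis k))) he.le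
  nlinarith

theorem isLorentzian_of_nonpos_on_hyperplane {n : ℕ} {M : Matrix (Fin n) (Fin n) ℝ}
    (hS : M.IsSymm) (h0 : ∀ i j, 0 ≤ M i j) (u : Fin n → ℝ)
    (hu : ∀ y, y ⬝ᵥ u = 0 → y ⬝ᵥ M *ᵥ y ≤ 0) : IsLorentzian M := by
  refine ⟨hS, h0, fun hH => Finset.card_le_one.2 fun i hi j hj => ?_⟩
  simp only [Finset.mem_filter, Finset.mem_univ, true_and] at hi hj
  by_contra hij
  have hform : ∀ c d : ℝ, (c • (⇑(hH.eigenvectorBasis i) : Fin n → ℝ) +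
      d • (⇑(hH.eigenvectorBasis j) : Fin n → ℝ)) ⬝ᵥ M *ᵥ (c • ⇑(hH.eigenvectorBasis i) +
      d • ⇑(hH.eigenvectorBasis j)) = hH.eigenvalues i * c ^ 2 + hH.eigenvalues j * d ^ 2 := by
    intro c d
    simp only [mulVec_add, mulVec_smul, hH.mulVec_eigenvectorBasis, add_dotProduct,
      smul_dotProduct, dotProduct_add, dotProduct_smul, smul_eq_mul,
      dotProduct_eigenvectorBasis, if_neg hij, if_neg (Ne.symm hij), if_true]
    ring
  by_cases hz : (⇑(hH.eigenvectorBasis i) : Fin n → ℝ) ⬝ᵥ u = 0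
  · have h := hu ((1 : ℝ) • ⇑(hH.eigenvectorBasis i) + (0 : ℝ) • ⇑(hH.eigenvectorBasis j))
      (by simp [hz])
    rw [hform] at h
    linarith
  · have h := hu ((⇑(hH.eigenvectorBasis j) ⬝ᵥ u) • ⇑(hH.eigenvectorBasis i) +
      (-(⇑(hH.eigenvectorBasis i) ⬝ᵥ u)) • ⇑(hH.eigenvectorBasis j))
      (by simp only [add_dotProduct, smul_dotProduct, smul_eq_mul]; ring)
    rw [hform] at h
    have h1 := mul_pos hj (sq_pos_of_ne_zero hz)
    have h2 := mul_nonneg hi.le (sq_nonneg (⇑(hH.eigenvectorBasis j) ⬝ᵥ u))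
    nlinarith

theorem IsLorentzian.div_le_two_mul {n : ℕ} {M : Matrix (Fin n) (Fin n) ℝ}
    (hM : IsLorentzian M) (hpos : ∀ i j, 0 < M i j) (w i j k : Fin n) :
    M i k / (M i w * M k w) ≤
      2 * (M i j / (M i w * M j w) + M j k / (M j w * M k w)) := by
  have hs : ∀ a b, M a b = M b a := fun a b => hM.1.apply b a
  have hi := hpos i w
  have hj := hpos j w
  have hk := hpos k w
  have h := hM.dotProduct_mulVec_nonpos (e := Pi.single w 1)
    (x := (M i w)⁻¹ • Pi.single i 1 - (2 * (M j w)⁻¹) • Pi.single j 1 +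
      (M k w)⁻¹ • Pi.single k 1)
    (by simpa using hpos w w)
    (by
      simp only [add_dotProduct, sub_dotProduct, smul_dotProduct, mulVec_single_one,
        single_one_dotProduct, smul_eq_mul, col_apply]
      field_simp
      ring)
  simp only [mulVec_add, mulVec_sub, mulVec_smul, add_dotProduct, sub_dotProduct, smul_dotProduct,
    dotProduct_add, dotProduct_sub, dotProduct_smul, mulVec_single_one,
    single_one_dotProduct, smul_eq_mul, col_apply] at h
  rw [hs k i, hs j i, hs k j] at h
  have e1 : M i k / (M i w * M k w) = (M i w)⁻¹ * (M k w)⁻¹ * M i k := by field_simp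
  have e2 : M i j / (M i w * M j w) = (M i w)⁻¹ * (M j w)⁻¹ * M i j := by field_simp
  have e3 : M j k / (M j w * M k w) = (M j w)⁻¹ * (M k w)⁻¹ * M j k := by field_simp
  rw [e1, e2, e3]
  have p1 : 0 < (M i w)⁻¹ * (M i w)⁻¹ * M i i := by have := hpos i i; positivity
  have p2 : 0 < (M j w)⁻¹ * (M j w)⁻¹ * M j j := by have := hpos j j; positivity
  have p3 : 0 < (M k w)⁻¹ * (M k w)⁻¹ * M k k := by have := hpos k k; positivity
  linarith

open Classical in
theorem sum_partialEquiv_nonpos {n : ℕ} {α : Fin n → Fin n → ℝ}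
    (hα : ∀ S : Finset (Fin n), ∑ q ∈ offDiagPairs n, α q.1 q.2 * cutVec S q.1 q.2 ≤ 0)
    {P : Fin n → Fin n → Prop} (hsymm : ∀ i j, P i j → P j i)
    (htrans : ∀ i j k, P i j → P j k → P i k) :
    ∑ q ∈ offDiagPairs n, α q.1 q.2 * ((if P q.1 q.1 then 1 else 0) +
      (if P q.2 q.2 then 1 else 0) - 2 * (if P q.1 q.2 then 1 else 0)) ≤ 0 := by
  let cls : Fin n → Finset (Fin n) := fun i => Finset.univ.filter (P i)
  let A : Finset (Finset (Fin n)) := Finset.univ.image cls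
  have hcls : ∀ i, ∀ S ∈ A, i ∈ S ↔ P i i ∧ S = cls i := by
    intro i S hS
    obtain ⟨k, -, rfl⟩ := Finset.mem_image.1 hS
    simp only [cls, Finset.mem_filter, Finset.mem_univ, true_and, Finset.ext_iff]
    constructor
    · intro h
      exact ⟨htrans _ _ _ (hsymm _ _ h) h, fun a =>
        ⟨fun ha => htrans _ _ _ (hsymm _ _ h) ha, fun ha => htrans _ _ _ h ha⟩⟩
    · rintro ⟨h1, h2⟩
      exact (h2 i).2 h1
  have hsum : ∀ i j, ∑ S ∈ A, (if i ∈ S ∧ j ∈ S then (1 : ℝ) else 0) =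
      if P i j then 1 else 0 := by
    intro i j
    rw [Finset.sum_congr rfl (g := fun S => if S = cls i then (if P i j then (1 : ℝ) else 0) else 0)]
    · rw [Finset.sum_ite_eq', if_pos (Finset.mem_image_of_mem _ (Finset.mem_univ i))]
    · intro S hS
      rw [← ite_and]
      refine if_congr ?_ rfl rfl
      rw [hcls i S hS]
      constructor
      · rintro ⟨⟨-, rfl⟩, h⟩
        exact ⟨rfl, by simpa [cls] using h⟩
      · rintro ⟨rfl, h⟩
        exact ⟨⟨htrans _ _ _ h (hsymm _ _ h), rfl⟩, by simpa [cls] using h⟩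
  have hcut : ∀ i j, ∑ S ∈ A, cutVec S i j = (if P i i then 1 else 0) +
      (if P j j then 1 else 0) - 2 * (if P i j then 1 else 0) := by
    intro i j
    rw [← hsum i i, ← hsum j j, ← hsum i j, Finset.mul_sum, ← Finset.sum_add_distrib,
      ← Finset.sum_sub_distrib]
    refine Finset.sum_congr rfl fun S _ => ?_
    by_cases hi : i ∈ S <;> by_cases hj : j ∈ S <;> simp [cutVec, hi, hj]
    norm_num
  calc _ = ∑ S ∈ A, ∑ q ∈ offDiagPairs n, α q.1 q.2 * cutVec S q.1 q.2 := by
        rw [Finset.sum_comm]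
        refine Finset.sum_congr rfl fun q _ => ?_
        rw [← Finset.mul_sum, hcut]
    _ ≤ 0 := Finset.sum_nonpos fun S _ => hα S

open Classical in
theorem sum_le_of_int_quasi_ultrametric {n : ℕ} {α : Fin n → Fin n → ℝ}
    (hα : ∀ S : Finset (Fin n), ∑ q ∈ offDiagPairs n, α q.1 q.2 * cutVec S q.1 q.2 ≤ 0)
    {C : ℤ} (hC : 0 ≤ C) {ℓ : Fin n → Fin n → ℤ} (hsymm : ∀ i j, ℓ i j = ℓ j i)
    (hquasi : ∀ i j k, ℓ i k ≤ max (ℓ i j) (ℓ j k) + C) :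
    ∑ q ∈ offDiagPairs n, α q.1 q.2 *
      (2 * (ℓ q.1 q.2 : ℝ) - ℓ q.1 q.1 - ℓ q.2 q.2) ≤
      (∑ q ∈ offDiagPairs n, |α q.1 q.2|) * (2 * (C * (n + 1))) := by
  let P : ℤ → Fin n → Fin n → Prop := fun t => Relation.TransGen fun a b => ℓ a b ≤ t
  obtain ⟨K, hK⟩ : ∃ K : ℤ, ∀ i j, |ℓ i j| ≤ K := by
    refine ⟨∑ q : Fin n × Fin n, |ℓ q.1 q.2|, fun i j => ?_⟩
    exact Finset.single_le_sum (f := fun q : Fin n × Fin n => |ℓ q.1 q.2|)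
      (fun q _ => abs_nonneg _) (Finset.mem_univ (i, j))
  let s : Fin n → Fin n → ℝ := fun i j => ∑ t ∈ Finset.Ico (-K) K, if P t i j then 1 else 0
  have hD : 0 ≤ C * (n + 1) := by positivity
  have hlow : ∀ i j, (K : ℝ) - ℓ i j ≤ s i j := by
    intro i j
    simp only [s, Finset.sum_boole]
    have h1 : Finset.Ico (ℓ i j) K ⊆ (Finset.Ico (-K) K).filter fun t => P t i j := by
      intro t ht
      rw [Finset.mem_Ico] at ht
      rw [Finset.mem_filter, Finset.mem_Ico]
      have := abs_le.1 (hK i j)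
      exact ⟨⟨by linarith, ht.2⟩, Relation.TransGen.single ht.1⟩
    have h2 := Finset.card_le_card h1
    rw [Int.card_Ico] at h2
    have h3 : K - ℓ i j ≤ ((Finset.Ico (-K) K).filter fun t => P t i j).card := by omega
    exact_mod_cast h3
  have hhigh : ∀ i j, s i j ≤ (K : ℝ) - ℓ i j + C * (n + 1) := by
    intro i j
    simp only [s, Finset.sum_boole]
    have h1 : ((Finset.Ico (-K) K).filter fun t => P t i j) ⊆
        Finset.Ico (ℓ i j - C * (n + 1)) K := by
      intro t ht
      rw [Finset.mem_filter, Finset.mem_Ico] at ht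
      have := le_of_transGen hC hsymm hquasi ht.2
      rw [Finset.mem_Ico]
      exact ⟨by linarith, ht.1.2⟩
    have h2 := Finset.card_le_card h1
    rw [Int.card_Ico] at h2
    have := abs_le.1 (hK i j)
    have h3 : (((Finset.Ico (-K) K).filter fun t => P t i j).card : ℤ) ≤
        K - ℓ i j + C * (n + 1) := by
      generalize C * ((n : ℤ) + 1) = D at *
      omega
    exact_mod_cast h3
  have hs : ∑ q ∈ offDiagPairs n, α q.1 q.2 * (s q.1 q.1 + s q.2 q.2 - 2 * s q.1 q.2) ≤ 0 := by
    calc _ = ∑ t ∈ Finset.Ico (-K) K, ∑ q ∈ offDiagPairs n, α q.1 q.2 *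
          ((if P t q.1 q.1 then 1 else 0) + (if P t q.2 q.2 then 1 else 0) -
            2 * (if P t q.1 q.2 then 1 else 0)) := by
          rw [Finset.sum_comm]
          refine Finset.sum_congr rfl fun q _ => ?_
          rw [← Finset.mul_sum, Finset.sum_sub_distrib, Finset.sum_add_distrib, ← Finset.mul_sum]
      _ ≤ 0 := Finset.sum_nonpos fun t _ => sum_partialEquiv_nonpos hα
          (fun i j h => by
            have : Std.Symm fun a b => ℓ a b ≤ t := ⟨fun a b h => by rwa [hsymm]⟩
            exact Relation.TransGen.stdSymm.symm _ _ h)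
          (fun i j k h1 h2 => h1.trans h2)
  calc _ ≤ ∑ q ∈ offDiagPairs n, (α q.1 q.2 * (s q.1 q.1 + s q.2 q.2 - 2 * s q.1 q.2) +
        |α q.1 q.2| * (2 * (C * (n + 1)))) := by
        refine Finset.sum_le_sum fun q _ => ?_
        rw [← sub_le_iff_le_add', ← mul_sub]
        refine (le_abs_self _).trans ?_
        rw [abs_mul]
        refine mul_le_mul_of_nonneg_left (abs_le.2 ?_) (abs_nonneg _)
        have a1 := hlow q.1 q.1
        have a2 := hlow q.2 q.2
        have a3 := hlow q.1 q.2
        have b1 := hhigh q.1 q.1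
        have b2 := hhigh q.2 q.2
        have b3 := hhigh q.1 q.2
        constructor <;> linarith
    _ ≤ _ := by
        rw [Finset.sum_add_distrib, ← Finset.sum_mul]
        linarith

theorem sum_le_of_quasi_ultrametric {n : ℕ} {α : Fin n → Fin n → ℝ}
    (hα : ∀ S : Finset (Fin n), ∑ q ∈ offDiagPairs n, α q.1 q.2 * cutVec S q.1 q.2 ≤ 0)
    {C : ℤ} (hC : 0 ≤ C) {L : Fin n → Fin n → ℝ} (hsymm : ∀ i j, L i j = L j i)
    (hquasi : ∀ i j k, L i k ≤ max (L i j) (L j k) + C) :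
    ∑ q ∈ offDiagPairs n, α q.1 q.2 * (2 * L q.1 q.2 - L q.1 q.1 - L q.2 q.2) ≤
      (∑ q ∈ offDiagPairs n, |α q.1 q.2|) * (2 * (C * (n + 1)) + 2) := by
  have h := sum_le_of_int_quasi_ultrametric hα hC (ℓ := fun i j => ⌈L i j⌉)
    (fun i j => by rw [hsymm]) (fun i j k => by
      refine Int.ceil_le.2 ((hquasi i j k).trans ?_)
      push_cast
      gcongr <;> exact Int.le_ceil _)
  calc _ ≤ ∑ q ∈ offDiagPairs n, (α q.1 q.2 *
        (2 * (⌈L q.1 q.2⌉ : ℝ) - ⌈L q.1 q.1⌉ - ⌈L q.2 q.2⌉) + |α q.1 q.2| * 2) := by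
        refine Finset.sum_le_sum fun q _ => ?_
        rw [← sub_le_iff_le_add', ← mul_sub]
        refine (le_abs_self _).trans ?_
        rw [abs_mul]
        refine mul_le_mul_of_nonneg_left (abs_le.2 ?_) (abs_nonneg _)
        have a1 := Int.le_ceil (L q.1 q.1)
        have a2 := Int.le_ceil (L q.2 q.2)
        have a3 := Int.le_ceil (L q.1 q.2)
        have b1 := Int.ceil_lt_add_one (L q.1 q.1)
        have b2 := Int.ceil_lt_add_one (L q.2 q.2)
        have b3 := Int.ceil_lt_add_one (L q.1 q.2)
        constructor <;> linarith
    _ ≤ _ := by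
        rw [Finset.sum_add_distrib, ← Finset.sum_mul, mul_add]
        linarith

theorem prod_rpow_eq_exp {ι : Type*} (s : Finset ι) {f a : ι → ℝ} (hf : ∀ i ∈ s, 0 < f i) :
    ∏ i ∈ s, f i ^ a i = Real.exp (∑ i ∈ s, a i * Real.log (f i)) := by
  rw [Real.exp_sum]
  exact Finset.prod_congr rfl fun i hi => by rw [Real.rpow_def_of_pos (hf i hi), mul_comm]

theorem IsLorentzian.sum_mul_log_le {n : ℕ} {α : Fin n → Fin n → ℝ}
    (hα : ∀ S : Finset (Fin n), ∑ q ∈ offDiagPairs n, α q.1 q.2 * cutVec S q.1 q.2 ≤ 0)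
    {M : Matrix (Fin n) (Fin n) ℝ} (hM : IsLorentzian M) (hdiag : ∀ i, M i i = 1)
    (hpos : ∀ i j, 0 < M i j) (w : Fin n) :
    ∑ q ∈ offDiagPairs n, α q.1 q.2 * Real.log (M q.1 q.2) ≤
      (∑ q ∈ offDiagPairs n, |α q.1 q.2|) * (2 * (n + 1) + 1) := by
  let N : Fin n → Fin n → ℝ := fun i j => M i j / (M i w * M j w)
  have hN : ∀ i j, 0 < N i j := fun i j => div_pos (hpos i j) (mul_pos (hpos i w) (hpos j w))
  have hlog : ∀ i j, Real.log (N i j) =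
      Real.log (M i j) - (Real.log (M i w) + Real.log (M j w)) := fun i j => by
    rw [Real.log_div (hpos i j).ne' (mul_pos (hpos i w) (hpos j w)).ne',
      Real.log_mul (hpos i w).ne' (hpos j w).ne']
  have h := sum_le_of_quasi_ultrametric hα (C := 2) (by norm_num)
    (L := fun i j => Real.log (N i j))
    (fun i j => by simp only [N]; rw [hM.1.apply j i, mul_comm])
    (fun i j k => by
      have h1 : N i k ≤ 2 * (N i j + N j k) := hM.div_le_two_mul hpos w i j k
      have hexp : (4 : ℝ) ≤ Real.exp 2 := by
        have h2 := Real.add_one_le_exp (1 : ℝ)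
        have h3 : Real.exp 2 = Real.exp 1 * Real.exp 1 := by rw [← Real.exp_add]; norm_num
        nlinarith
      rw [Real.log_le_iff_le_exp (hN i k)]
      push_cast
      rw [Real.exp_add]
      have h4 : N i j ≤ Real.exp (max (Real.log (N i j)) (Real.log (N j k))) :=
        (Real.log_le_iff_le_exp (hN i j)).1 (le_max_left _ _)
      have h5 : N j k ≤ Real.exp (max (Real.log (N i j)) (Real.log (N j k))) :=
        (Real.log_le_iff_le_exp (hN j k)).1 (le_max_right _ _)
      nlinarith [hN i j])
  have h2 : ∑ q ∈ offDiagPairs n, α q.1 q.2 * (2 * Real.log (N q.1 q.2) -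
      Real.log (N q.1 q.1) - Real.log (N q.2 q.2)) =
      2 * ∑ q ∈ offDiagPairs n, α q.1 q.2 * Real.log (M q.1 q.2) := by
    rw [Finset.mul_sum]
    refine Finset.sum_congr rfl fun q _ => ?_
    simp only [hlog, hdiag, Real.log_one]
    ring
  rw [h2] at h
  push_cast at h
  linarith

theorem isLorentzian_exp_cutVec {n : ℕ} (S : Finset (Fin n)) {t : ℝ} (ht : 0 ≤ t) :
    IsLorentzian (Matrix.of fun i j => Real.exp (t * cutVec S i j)) := by
  refine isLorentzian_of_nonpos_on_hyperplane ?_ (fun i j => (Real.exp_pos _).le) 1 ?_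
  · ext i j
    simp [cutVec, iff_comm]
  · intro y hy
    let z : Fin n → ℝ := fun i => if i ∈ S then y i else 0
    have hz : ∀ i j, y i * (Real.exp (t * cutVec S i j) * y j) = y i * y j +
        (Real.exp t - 1) * (z i * y j + y i * z j - 2 * (z i * z j)) := by
      intro i j
      by_cases hi : i ∈ S <;> by_cases hj : j ∈ S <;> simp [cutVec, hi, hj, z] <;>
        first | ring1 | (right; ring1)
    have hy' : ∑ i, y i = 0 := by simpa [dotProduct] using hy
    have hform : y ⬝ᵥ (Matrix.of fun i j => Real.exp (t * cutVec S i j)) *ᵥ y =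
        -(2 * (Real.exp t - 1) * (∑ i, z i) ^ 2) := by
      simp only [dotProduct, mulVec, Matrix.of_apply, Finset.mul_sum, hz]
      simp only [Finset.sum_add_distrib, Finset.sum_sub_distrib, ← Finset.mul_sum,
        ← Finset.sum_mul, hy']
      ring
    rw [hform, neg_nonpos]
    have := Real.one_le_exp ht
    exact mul_nonneg (by linarith) (sq_nonneg _)

theorem reducedBR_eq_dual_cut_cone (n : ℕ) (hn : 0 < n) (α : Fin n → Fin n → ℝ) :
    (∃ c : ℝ, 0 < c ∧ ∀ M : Matrix (Fin n) (Fin n) ℝ,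
        IsLorentzian M → (∀ i, M i i = 1) → (∀ i j, 0 < M i j) →
        ∏ q ∈ offDiagPairs n, M q.1 q.2 ^ α q.1 q.2 ≤ c) ↔
    (∀ S : Finset (Fin n),
        ∑ q ∈ offDiagPairs n, α q.1 q.2 * cutVec S q.1 q.2 ≤ 0) := by
  constructor
  · rintro ⟨c, hc, h⟩ S
    by_contra! hpos
    set σ := ∑ q ∈ offDiagPairs n, α q.1 q.2 * cutVec S q.1 q.2 with hσ
    have key : ∀ t : ℝ, 0 ≤ t → Real.exp (t * σ) ≤ c := by
      intro t ht
      have h1 := h _ (isLorentzian_exp_cutVec S ht) (fun i => by simp [cutVec])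
        (fun i j => Real.exp_pos _)
      rw [prod_rpow_eq_exp (offDiagPairs n) (a := fun q => α q.1 q.2)
        (f := fun q => Matrix.of (fun i j => Real.exp (t * cutVec S i j)) q.1 q.2)
        fun q _ => Real.exp_pos _] at h1
      convert h1 using 2
      rw [hσ, Finset.mul_sum]
      refine Finset.sum_congr rfl fun q _ => ?_
      rw [Matrix.of_apply, Real.log_exp]
      ring
    have h1 := key (c / σ) (by positivity)
    rw [div_mul_cancel₀ _ hpos.ne'] at h1
    linarith [Real.add_one_le_exp c]
  · intro hα
    refine ⟨Real.exp ((∑ q ∈ offDiagPairs n, |α q.1 q.2|) * (2 * (n + 1) + 1)), Real.exp_pos _,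
      fun M hM hdiag hpos => ?_⟩
    rw [prod_rpow_eq_exp _ fun q _ => hpos _ _]
    exact Real.exp_le_exp.2 (hM.sum_mul_log_le hα hdiag hpos ⟨0, hn⟩)
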